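/- Let S³ denote the unit sphere in ℝ⁴ = EuclideanSpace ℝ (Fin 4), with the induced metric and subspace topology. Let S ⊆ S³ be a compact connected set such that every point of S has an open neighbourhood in S homeomorphic to ℝ², and let K, K' ⊆ S³ be nonempty compact connected sets which S separates, meaning: K and K' are contained in S³ \ S and no connected subset of S³ \ S meets both K and K'. Then there exists ε > 0 such that for every continuous injective map h : S → S³ with dist(h(x), x) < ε for all x ∈ S, the set S' := h(S) also separates K and K'; that is, K and K' are contained in S³ \ S' and no connected subset of S³ \ S' meets both K and K'. -/

import Mathlib

open Metric Set MeasureTheory Topology Module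

section NoRetraction

variable {E : Type*} [NormedAddCommGroup E] [InnerProductSpace ℝ E] [FiniteDimensional ℝ E]

theorem Matrix.det_one_add_smul_fin_three (M : Matrix (Fin 3) (Fin 3) ℝ) (t : ℝ) :
    (1 + t • M).det =
      1 + t * M.trace + t ^ 2 * ((1 + M).det - 1 - M.trace - M.det) + t ^ 3 * M.det := by
  simp [Matrix.det_fin_three, Matrix.trace_fin_three]
  ring

theorem LinearMap.det_one_add_smul_of_finrank_eq_three (hE : finrank ℝ E = 3)
    (A : E →ₗ[ℝ] E) (t : ℝ) :
    LinearMap.det (1 + t • A) =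
      1 + t * LinearMap.trace ℝ E A +
        t ^ 2 * (LinearMap.det (1 + A) - 1 - LinearMap.trace ℝ E A - LinearMap.det A) +
        t ^ 3 * LinearMap.det A := by
  let b := finBasisOfFinrankEq ℝ E hE
  have h := Matrix.det_one_add_smul_fin_three (LinearMap.toMatrix b b A) t
  rw [← LinearMap.det_toMatrix b, ← LinearMap.det_toMatrix b, ← LinearMap.det_toMatrix b,
    LinearMap.trace_eq_matrix_trace ℝ b]
  simpa using h

omit [FiniteDimensional ℝ E] in
/-- Extending by zero a Lipschitz map vanishing on a sphere keeps it Lipschitz. -/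
theorem LipschitzOnWith.indicator_closedBall {F : Type*} [NormedAddCommGroup F] {R : ℝ}
    {u : E → F} {L : NNReal} (hu : LipschitzOnWith L u (closedBall 0 R))
    (h0 : ∀ x, ‖x‖ = R → u x = 0) :
    LipschitzWith L ((closedBall (0 : E) R).indicator u) := by
  have key : ∀ x ∈ closedBall (0 : E) R, ∀ y ∉ closedBall (0 : E) R,
      ‖u x‖ ≤ L * ‖x - y‖ := by
    intro x hx y hy
    have hseg : ∃ z ∈ segment ℝ x y, ‖z‖ = R := by
      have := (convex_segment x y).isPreconnected.intermediate_value (left_mem_segment ℝ x y)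
        (right_mem_segment ℝ x y) continuous_norm.continuousOn
      simp only [mem_closedBall, dist_zero_right, not_le] at hx hy
      obtain ⟨z, hz, h⟩ := this ⟨hx, hy.le⟩
      exact ⟨z, hz, h⟩
    obtain ⟨z, hz, hzR⟩ := hseg
    have h1 := hu.norm_sub_le hx (show z ∈ closedBall (0 : E) R by simp [hzR])
    rw [h0 z hzR, sub_zero] at h1
    refine h1.trans ?_
    gcongr
    obtain ⟨θ, ⟨hθ0, hθ1⟩, rfl⟩ := segment_eq_image' ℝ x y ▸ hz
    have : x - (x + θ • (y - x)) = θ • (x - y) := by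
      rw [← neg_sub x y, smul_neg]; abel
    rw [this, norm_smul, Real.norm_of_nonneg hθ0]
    exact mul_le_of_le_one_left (norm_nonneg _) hθ1
  refine LipschitzWith.of_dist_le_mul fun x y => ?_
  rw [dist_eq_norm, dist_eq_norm]
  by_cases hx : x ∈ closedBall (0 : E) R <;> by_cases hy : y ∈ closedBall (0 : E) R
  · simpa [indicator_of_mem hx, indicator_of_mem hy] using hu.norm_sub_le hx hy
  · simpa [indicator_of_mem hx, indicator_of_notMem hy] using key x hx y hy
  · simpa [indicator_of_notMem hx, indicator_of_mem hy, norm_sub_rev x y] using key y hy x hx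
  · simp only [indicator_of_notMem hx, indicator_of_notMem hy, sub_zero, norm_zero]
    positivity

/-- A bijection of the space that is the identity off a set preserves that set. -/
theorem Function.Bijective.image_eq_of_forall_notMem {α : Type*} {f : α → α} {s : Set α}
    (hf : Function.Bijective f) (hs : ∀ x ∉ s, f x = x) : f '' s = s := by
  ext y
  constructor
  · rintro ⟨x, hx, rfl⟩
    by_contra h
    exact h (by rwa [hf.1 (hs _ h)])
  · intro hy
    obtain ⟨x, rfl⟩ := hf.2 y
    refine ⟨x, ?_, rfl⟩
    by_contra h
    exact h (by rwa [hs _ h] at hy)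

theorem LipschitzWith.bijective_id_add_smul {v : E → E} {L : NNReal} (hv : LipschitzWith L v)
    {t : ℝ} (ht : ‖t‖₊ * L < 1) : Function.Bijective fun x => x + t • v x := by
  have happ : ApproximatesLinearOn (fun x => x + t • v x)
      ((ContinuousLinearEquiv.refl ℝ E : E ≃L[ℝ] E) : E →L[ℝ] E) univ (‖t‖₊ * L) := by
    intro x _ y _
    have : x + t • v x - (y + t • v y) -
        ((ContinuousLinearEquiv.refl ℝ E : E ≃L[ℝ] E) : E →L[ℝ] E) (x - y) =
        t • (v x - v y) := by
      simp [smul_sub]; abel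
    rw [this, norm_smul, NNReal.coe_mul, mul_assoc]
    simpa using mul_le_mul_of_nonneg_left (hv.norm_sub_le x y) (norm_nonneg t)
  rcases subsingleton_or_nontrivial E with hE | hE
  · exact ⟨Function.injective_of_subsingleton _, fun y => ⟨y, Subsingleton.elim _ _⟩⟩
  have hc : Subsingleton E ∨ ‖t‖₊ * L <
      ‖((ContinuousLinearEquiv.refl ℝ E).symm : E →L[ℝ] E)‖₊⁻¹ := by
    right
    have : ‖((ContinuousLinearEquiv.refl ℝ E).symm : E →L[ℝ] E)‖₊ = 1 := by
      ext; exact ContinuousLinearMap.norm_id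
    rw [this]; simpa using ht
  refine ⟨fun x y hxy => happ.injOn hc (mem_univ _) (mem_univ _) hxy, happ.surjective hc⟩

variable [MeasurableSpace E] [BorelSpace E]

/-- For small `t`, the map `x ↦ x + t • u x` permutes the ball, so the integral of its Jacobian
is the volume of the ball. -/
theorem eventually_integral_det_one_add_smul_fderiv {R : ℝ} {u : E → E}
    (hu : ContDiff ℝ 1 u) (h0 : ∀ x, ‖x‖ = R → u x = 0) :
    ∀ᶠ t : ℝ in 𝓝 0, ∫ x in ball (0 : E) R, (1 + t • fderiv ℝ u x : E →L[ℝ] E).det =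
      volume.real (ball (0 : E) R) := by
  obtain ⟨L, hL⟩ : ∃ L, LipschitzOnWith L u (closedBall 0 R) :=
    hu.contDiffOn.exists_lipschitzOnWith one_ne_zero (convex_closedBall _ _)
      (isCompact_closedBall _ _)
  have hlip := hL.indicator_closedBall h0
  have hpos : ∀ᶠ t : ℝ in 𝓝 0, ∀ x ∈ closedBall (0 : E) R,
      0 < (1 + t • fderiv ℝ u x : E →L[ℝ] E).det := by
    refine (isCompact_closedBall _ _).eventually_forall_of_forall_eventually fun y _ => ?_
    have hc : Continuous fun z : ℝ × E => (1 + z.1 • fderiv ℝ u z.2 : E →L[ℝ] E).det := by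
      have := hu.continuous_fderiv one_ne_zero
      exact ContinuousLinearMap.continuous_det.comp (by fun_prop)
    refine hc.continuousAt.eventually_const_lt ?_
    simp [ContinuousLinearMap.det]
  have hsmall : ∀ᶠ t : ℝ in 𝓝 0, ‖t‖₊ * L < 1 := by
    have : Continuous fun t : ℝ => ‖t‖₊ * L := by fun_prop
    exact this.continuousAt.eventually_lt_const (by simp)
  filter_upwards [hpos, hsmall] with t hpt hst
  set f : E → E := fun x => x + t • (closedBall (0 : E) R).indicator u x with hf
  have hbij : Function.Bijective f := hlip.bijective_id_add_smul hst
  have himg : f '' ball 0 R = ball 0 R := by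
    refine hbij.image_eq_of_forall_notMem fun x hx => ?_
    have : (closedBall (0 : E) R).indicator u x = 0 := by
      by_cases h : x ∈ closedBall (0 : E) R
      · rw [indicator_of_mem h]
        refine h0 x (le_antisymm (by simpa using h) (by simpa using hx))
      · exact indicator_of_notMem h _
    simp [hf, this]
  have hder : ∀ x ∈ ball (0 : E) R,
      HasFDerivWithinAt f (1 + t • fderiv ℝ u x : E →L[ℝ] E) (ball 0 R) x := by
    intro x hx
    have h1 : HasFDerivAt (fun x => x + t • u x) (1 + t • fderiv ℝ u x : E →L[ℝ] E) x :=
      (hasFDerivAt_id x).add (((hu.differentiable one_ne_zero) x).hasFDerivAt.const_smul t)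
    refine h1.hasFDerivWithinAt.congr (fun y hy => ?_) ?_
    · simp [hf, indicator_of_mem (ball_subset_closedBall hy)]
    · simp [hf, indicator_of_mem (ball_subset_closedBall hx)]
  have := integral_image_eq_integral_abs_det_fderiv_smul volume measurableSet_ball hder
    hbij.1.injOn (fun _ => (1 : ℝ))
  rw [himg] at this
  simp only [smul_eq_mul, mul_one, integral_const, MeasurableSet.univ, measureReal_restrict_apply,
    univ_inter] at this
  rw [this]
  refine setIntegral_congr_fun measurableSet_ball fun x hx => ?_
  exact (abs_of_pos (hpt x (ball_subset_closedBall hx))).symm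

/-- The integral of the Jacobian of a perturbation of the identity vanishing on the sphere is a
polynomial in the size of the perturbation, hence constant. -/
theorem integral_det_one_add_fderiv (hE : finrank ℝ E = 3) {R : ℝ} {u : E → E}
    (hu : ContDiff ℝ 1 u) (h0 : ∀ x, ‖x‖ = R → u x = 0) :
    ∫ x in ball (0 : E) R, (1 + fderiv ℝ u x : E →L[ℝ] E).det =
      volume.real (ball (0 : E) R) := by
  have hD := hu.continuous_fderiv one_ne_zero
  set a : E → ℝ := fun x => LinearMap.trace ℝ E (fderiv ℝ u x)
  set c : E → ℝ := fun x => (fderiv ℝ u x).det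
  set b : E → ℝ := fun x => (1 + fderiv ℝ u x : E →L[ℝ] E).det - 1 - a x - c x
  have ha : Continuous a :=
    (LinearMap.continuous_of_finiteDimensional
      ((LinearMap.trace ℝ E).comp (ContinuousLinearMap.coeLM ℝ))).comp hD
  have hc : Continuous c := ContinuousLinearMap.continuous_det.comp hD
  have hb : Continuous b :=
    (((ContinuousLinearMap.continuous_det.comp (continuous_const.add hD)).sub
      continuous_const).sub ha).sub hc
  have hint {g : E → ℝ} (hg : Continuous g) : IntegrableOn g (ball 0 R) :=
    (hg.continuousOn.integrableOn_compact (isCompact_closedBall 0 R)).mono_set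
      ball_subset_closedBall
  have hdet (t : ℝ) (x : E) : (1 + t • fderiv ℝ u x : E →L[ℝ] E).det =
      1 + t * a x + t ^ 2 * b x + t ^ 3 * c x :=
    LinearMap.det_one_add_smul_of_finrank_eq_three hE (fderiv ℝ u x : E →ₗ[ℝ] E) t
  have hpoly (t : ℝ) : ∫ x in ball (0 : E) R, (1 + t • fderiv ℝ u x : E →L[ℝ] E).det =
      volume.real (ball (0 : E) R) + t * (∫ x in ball (0 : E) R, a x) +
        t ^ 2 * (∫ x in ball (0 : E) R, b x) + t ^ 3 * ∫ x in ball (0 : E) R, c x := by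
    simp_rw [hdet]
    rw [integral_add, integral_add, integral_add, integral_const_mul, integral_const_mul,
      integral_const_mul]
    · simp
    all_goals exact hint (by fun_prop)
  obtain ⟨δ, hδ, hball⟩ :=
    Metric.eventually_nhds_iff.1 (eventually_integral_det_one_add_smul_fderiv hu h0)
  have hzero (s : ℝ) (hs : 0 < s) (hs' : s < δ) := (hpoly s).symm.trans
    (hball (by simpa [abs_of_pos hs] using hs'))
  have hquad (s : ℝ) (hs : 0 < s) (hs' : s < δ) :
      (∫ x in ball (0 : E) R, a x) + s * (∫ x in ball (0 : E) R, b x) +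
        s ^ 2 * ∫ x in ball (0 : E) R, c x = 0 := by
    have h := (hpoly s).symm.trans (hball (by simpa [abs_of_pos hs] using hs'))
    refine (mul_eq_zero.1 ?_).resolve_left hs.ne'
    linear_combination h
  have h1 := hquad (δ / 2) (by positivity) (by linarith)
  have h2 := hquad (δ / 4) (by positivity) (by linarith)
  have h3 := hquad (δ / 8) (by positivity) (by linarith)
  have hc0 : ∫ x in ball (0 : E) R, c x = 0 := by
    refine (mul_eq_zero.1 ?_).resolve_left (pow_ne_zero 2 hδ.ne')
    linear_combination 32 / 3 * h1 - 32 * h2 + 64 / 3 * h3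
  have hb0 : ∫ x in ball (0 : E) R, b x = 0 := by
    rw [hc0] at h1 h2
    refine (mul_eq_zero.1 ?_).resolve_left hδ.ne'
    linear_combination 4 * h1 - 4 * h2
  have ha0 : ∫ x in ball (0 : E) R, a x = 0 := by
    rw [hc0, hb0] at h1
    linear_combination h1
  simpa [ha0, hb0, hc0] using hpoly 1

/-- There is no `C¹` retraction of the ball onto the sphere. -/
theorem false_of_contDiff_of_norm_eq (hE : finrank ℝ E = 3) {R : ℝ} (hR : 0 < R) {r : E → E}
    (hr : ContDiff ℝ 1 r) (hnorm : ∀ x, ‖r x‖ = R) (hid : ∀ x, ‖x‖ = R → r x = x) : False := by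
  have hvol := integral_det_one_add_fderiv hE (u := fun x => r x - x) (R := R)
    (hr.sub contDiff_id) fun x hx => by simp [hid x hx]
  have hdiff (x : E) : DifferentiableAt ℝ r x := hr.differentiable one_ne_zero x
  have hfd (x : E) : (1 + fderiv ℝ (fun x => r x - x) x : E →L[ℝ] E) = fderiv ℝ r x := by
    have : fderiv ℝ (fun x => r x - x) x = fderiv ℝ r x - 1 :=
      ((hdiff x).hasFDerivAt.sub (hasFDerivAt_id x)).fderiv
    rw [this]; abel
  have horth (x v : E) : inner ℝ (r x) (fderiv ℝ r x v) = 0 := by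
    have h1 := (hdiff x).hasFDerivAt.inner ℝ (hdiff x).hasFDerivAt
    have h2 : (fun y => inner ℝ (r y) (r y)) = fun _ => R ^ 2 := by
      ext y; rw [real_inner_self_eq_norm_sq, hnorm]
    rw [h2] at h1
    have h3 := DFunLike.congr_fun (h1.unique (hasFDerivAt_const (R ^ 2) x)) v
    simp [real_inner_comm (r x)] at h3
    simpa [real_inner_comm] using h3
  have hdet (x : E) : (fderiv ℝ r x).det = 0 := by
    by_contra hne
    obtain ⟨v, hv⟩ := (LinearMap.equivOfDetNeZero (fderiv ℝ r x : E →ₗ[ℝ] E) hne).surjective (r x)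
    have hv' : fderiv ℝ r x v = r x := hv
    have := horth x v
    rw [hv', real_inner_self_eq_norm_sq, hnorm] at this
    exact hR.ne' (pow_eq_zero_iff two_ne_zero |>.1 this)
  simp_rw [hfd, hdet, integral_zero] at hvol
  exact (ENNReal.toReal_pos (measure_ball_pos volume (0 : E) hR).ne'
    measure_ball_lt_top.ne).ne hvol

omit [MeasurableSpace E] [BorelSpace E] in
/-- A continuous self-map that is the identity near infinity has a zero. -/
theorem exists_eq_zero_of_eq_id_off_ball (hE : finrank ℝ E = 3) {R : ℝ} {G : E → E}
    (hG : Continuous G) (hid : ∀ x, R ≤ ‖x‖ → G x = x) : ∃ x, G x = 0 := by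
  borelize E
  by_contra! hne
  wlog hR : 0 < R generalizing R
  · exact this (R := 1) (fun x hx => hid x (by linarith)) one_pos
  have hSU : {x : E | R < ‖x‖} ∈ 𝓝ˢ {x : E | R + 1 ≤ ‖x‖} :=
    (isOpen_lt continuous_const continuous_norm).mem_nhdsSet.2 fun x (hx : R + 1 ≤ ‖x‖) =>
      (lt_add_one R).trans_le hx
  obtain ⟨F, hF, hdist, hFid, -⟩ := hG.exists_contDiff_approx_and_eqOn 1 hG.norm
    (fun x => norm_pos_iff.2 (hne x)) (isClosed_le continuous_const continuous_norm) hSU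
    (contDiffOn_id.congr fun x (hx : R < ‖x‖) => hid x hx.le)
  have hF0 (x : E) : F x ≠ 0 := by
    intro h
    simpa [h] using hdist x
  refine false_of_contDiff_of_norm_eq hE (R := R + 1) (by positivity)
    (r := fun x => ((R + 1) * ‖F x‖⁻¹) • F x) ?_ ?_ ?_
  · exact (contDiff_const.mul ((hF.norm ℝ hF0).inv fun x => norm_ne_zero_iff.2 (hF0 x))).smul hF
  · intro x
    rw [norm_smul, norm_mul, norm_inv, norm_norm, mul_assoc,
      inv_mul_cancel₀ (norm_ne_zero_iff.2 (hF0 x)), mul_one, Real.norm_of_nonneg (by positivity)]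
  · intro x hx
    have : F x = x := (hFid hx.ge).trans (hid x (by linarith))
    rw [this, hx, mul_inv_cancel₀ (by positivity), one_smul]

end NoRetraction

section Extension

/-- The map `f` on `A` extends along `e : A → Y` to a continuous map without zeros. -/
def HasNonvanishingExtension {A Y E : Type*} [TopologicalSpace Y] [TopologicalSpace E] [Zero E]
    (e : A → Y) (f : A → E) : Prop :=
  ∃ F : Y → E, Continuous F ∧ (∀ y, F y ≠ 0) ∧ ∀ a, F (e a) = f a

theorem HasNonvanishingExtension.of_norm_sub_lt {A Y : Type*} {E : Type*} [TopologicalSpace A]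
    [TopologicalSpace Y] [NormalSpace Y] [NormedAddCommGroup E] [NormedSpace ℝ E]
    [FiniteDimensional ℝ E] {e : A → Y} (he : IsClosedEmbedding e) {f g : A → E}
    (hf : HasNonvanishingExtension e f) (hg : Continuous g)
    (hfg : ∀ a, ‖g a - f a‖ < ‖f a‖) : HasNonvanishingExtension e g := by
  obtain ⟨F, hF, hF0, hFe⟩ := hf
  obtain ⟨G, hG⟩ := ContinuousMap.exists_extension' he ⟨g, hg⟩
  have hGe (a : A) : G (e a) = g a := congr_fun hG a
  obtain ⟨φ, hφ0, hφ1, hφ⟩ := exists_continuous_zero_one_of_isClosed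
    (s := {y | ‖F y‖ ≤ ‖G y - F y‖}) (t := range e)
    (isClosed_le hF.norm (G.continuous.sub hF).norm) he.isClosed_range (by
      rw [Set.disjoint_right]
      rintro _ ⟨a, rfl⟩
      simpa [hGe, hFe] using hfg a)
  refine ⟨fun y => F y + φ y • (G y - F y), by fun_prop, fun y hy => ?_, fun a => ?_⟩
  · by_cases h : ‖F y‖ ≤ ‖G y - F y‖
    · simp [hφ0 h, hF0 y] at hy
    · have h1 : ‖F y‖ = φ y * ‖G y - F y‖ := by
        rw [← Real.norm_of_nonneg (hφ y).1, ← norm_smul, ← norm_neg (φ y • _)]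
        exact congrArg norm (eq_neg_of_add_eq_zero_left hy)
      exact h (h1.trans_le (mul_le_of_le_one_left (norm_nonneg _) (hφ y).2))
  · simp [hφ1 (mem_range_self a), hGe]

/-- If `e - p` extends without zeros, then `p` is not in a bounded complementary component
of the image of `e`. -/
theorem HasNonvanishingExtension.not_isBounded_connectedComponentIn {A E : Type*}
    [TopologicalSpace A] [NormedAddCommGroup E] [InnerProductSpace ℝ E] [FiniteDimensional ℝ E]
    (hE : finrank ℝ E = 3) {e : A → E} (he : IsClosedEmbedding e) {p : E} (hp : p ∉ range e)
    (h : HasNonvanishingExtension e fun a => e a - p) :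
    ¬ Bornology.IsBounded (connectedComponentIn (range e)ᶜ p) := by
  classical
  intro hb
  obtain ⟨F, hF, hF0, hFe⟩ := h
  set U := connectedComponentIn (range e)ᶜ p with hU
  have hXo : IsOpen (range e)ᶜ := he.isClosed_range.isOpen_compl
  have hUo : IsOpen U := hXo.connectedComponentIn
  have hpU : p ∈ U := mem_connectedComponentIn hp
  have hfr : ∀ x ∈ frontier U, F x = x - p := by
    intro x hx
    rw [hUo.frontier_eq] at hx
    have hxX : x ∈ range e := by
      by_contra hxX
      obtain ⟨y, hyV, hyU⟩ := _root_.mem_closure_iff.1 hx.1 _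
        (hXo.connectedComponentIn (x := x)) (mem_connectedComponentIn hxX)
      refine hx.2 ?_
      rw [hU, connectedComponentIn_eq hyU, ← connectedComponentIn_eq hyV]
      exact mem_connectedComponentIn hxX
    obtain ⟨a, rfl⟩ := hxX
    exact hFe a
  have hG : Continuous (U.piecewise F fun x => x - p) :=
    hF.piecewise hfr (continuous_id.sub continuous_const)
  obtain ⟨R, hR⟩ := hb.subset_ball p
  obtain ⟨x, hx⟩ := exists_eq_zero_of_eq_id_off_ball hE (R := R)
    (hG.comp (continuous_id.add (continuous_const (y := p)))) fun x hx => by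
      have : x + p ∉ U := fun hxU => by
        have := hR hxU
        rw [mem_ball, dist_eq_norm, add_sub_cancel_right] at this
        exact this.not_ge hx
      simp [piecewise_eq_of_notMem _ _ _ this]
  by_cases hxU : x + p ∈ U
  · simp [piecewise_eq_of_mem _ _ _ hxU, hF0] at hx
  · simp [piecewise_eq_of_notMem _ _ _ hxU] at hx
    simp [hx, hpU] at hxU

end Extension

section OnePointChart

variable {M : Type*} [TopologicalSpace M] [T2Space M] {E : Type*} [NormedAddCommGroup E]
  [NormedSpace ℝ E] [FiniteDimensional ℝ E] {σ : OpenPartialHomeomorph M E} {b : M}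

omit [NormedSpace ℝ E] [FiniteDimensional ℝ E] [T2Space M] in
/-- If `M` is compact and `σ` is a global chart off the point `b`, adding `b` to the preimage of
an unbounded connected set keeps it connected. -/
theorem IsPreconnected.insert_image_symm_of_not_isBounded [CompactSpace M]
    (hsource : σ.source = {b}ᶜ) (htarget : σ.target = univ) {U : Set E}
    (hU : IsPreconnected U) (hb : ¬ Bornology.IsBounded U) :
    IsPreconnected (insert b (σ.symm '' U)) := by
  have himg : IsPreconnected (σ.symm '' U) :=
    hU.image _ (σ.continuousOn_symm.mono (by simp [htarget]))
  refine himg.subset_closure (subset_insert _ _) (insert_subset ?_ subset_closure)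
  by_contra hcl
  rw [_root_.mem_closure_iff] at hcl
  push Not at hcl
  obtain ⟨N, hN, hbN, hdisj⟩ := hcl
  have hc : IsCompact (σ '' Nᶜ) := hN.isClosed_compl.isCompact.image_of_continuousOn
    (σ.continuousOn.mono fun x hx => by
      rw [hsource]; rintro rfl; exact hx hbN)
  refine hb (hc.isBounded.subset fun x hx => ⟨σ.symm x, fun hxN => ?_, ?_⟩)
  · exact (Set.eq_empty_iff_forall_notMem.1 hdisj _) ⟨hxN, mem_image_of_mem _ hx⟩
  · exact σ.right_inv (by simp [htarget])

/-- If `b` and `p` lie in a connected subset of the complement of the image of `h`, then `h - p`,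
computed in a global chart off `b`, extends without zeros. -/
theorem IsPreconnected.hasNonvanishingExtension {A Y : Type*} [TopologicalSpace A]
    [CompactSpace A] [TopologicalSpace Y] [NormalSpace Y] {e : A → Y} (he : IsClosedEmbedding e)
    (hsource : σ.source = {b}ᶜ) (htarget : σ.target = univ) {h : A → M} (hh : Continuous h)
    {C : Set M} (hC : IsPreconnected C) (hCh : C ⊆ (range h)ᶜ) (hbC : b ∈ C) {p : M}
    (hpC : p ∈ C) (hpb : p ≠ b) :
    HasNonvanishingExtension e fun a => σ (h a) - σ p := by
  have hmem {x : M} (hx : x ≠ b) : x ∈ σ.source := by rw [hsource]; exact hx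
  have hhb (a : A) : h a ≠ b := fun hab => hCh hbC ⟨a, hab⟩
  have hσh : Continuous fun a => σ (h a) := continuous_iff_continuousAt.2 fun a =>
    (σ.continuousAt (hmem (hhb a))).comp hh.continuousAt
  set P : Set M := {q | q = b ∨ HasNonvanishingExtension e fun a => σ (h a) - σ q}
  have hro : IsOpen (range h)ᶜ := (isCompact_range hh).isClosed.isOpen_compl
  have hnear {q : M} (hq : q ∈ (range h)ᶜ) (hqb : q ≠ b) :
      ∀ᶠ q' in 𝓝 q, q' ≠ b ∧ ((HasNonvanishingExtension e fun a => σ (h a) - σ q) ↔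
        HasNonvanishingExtension e fun a => σ (h a) - σ q') := by
    have hev : ∀ᶠ q' in 𝓝 q, ∀ a ∈ (univ : Set A),
        ‖σ q' - σ q‖ < ‖σ (h a) - σ q‖ ∧ ‖σ q' - σ q‖ < ‖σ (h a) - σ q'‖ := by
      refine isCompact_univ.eventually_forall_of_forall_eventually fun a _ => ?_
      have h1 : ContinuousAt (fun z : M × A => σ z.1) (q, a) :=
        ContinuousAt.comp (f := Prod.fst) (σ.continuousAt (hmem hqb)) continuousAt_fst
      have h2 : ContinuousAt (fun z : M × A => σ (h z.2)) (q, a) :=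
        (hσh.comp continuous_snd).continuousAt
      have h3 : ‖σ q - σ q‖ < ‖σ (h a) - σ q‖ := by
        rw [sub_self, norm_zero, norm_pos_iff, sub_ne_zero]
        exact fun heq => hq ⟨a, σ.injOn (hmem (hhb a)) (hmem hqb) heq⟩
      exact (ContinuousAt.eventually_lt (h1.sub continuousAt_const).norm
        (h2.sub continuousAt_const).norm h3).and
        (ContinuousAt.eventually_lt (h1.sub continuousAt_const).norm (h2.sub h1).norm h3)
    filter_upwards [hev, isOpen_ne.mem_nhds hqb] with q' hq' hq'b
    refine ⟨hq'b, fun H => H.of_norm_sub_lt he (hσh.sub continuous_const) fun a => ?_,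
      fun H => H.of_norm_sub_lt he (hσh.sub continuous_const) fun a => ?_⟩
    · rw [sub_sub_sub_cancel_left, norm_sub_rev]
      exact (hq' a (mem_univ a)).1
    · rw [sub_sub_sub_cancel_left]
      exact (hq' a (mem_univ a)).2
  have hbnear : ∀ᶠ q in 𝓝 b, q ∈ P := by
    obtain ⟨R, hR0, hR⟩ := (isCompact_range hσh).isBounded.exists_pos_norm_le
    have hcpt : IsCompact (σ.symm '' closedBall (0 : E) R) :=
      (isCompact_closedBall _ _).image_of_continuousOn
        (σ.continuousOn_symm.mono (by simp [htarget]))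
    have hbn : b ∉ σ.symm '' closedBall (0 : E) R := by
      rintro ⟨x, -, hx⟩
      have := σ.map_target (x := x) (by simp [htarget])
      rw [hx, hsource] at this
      exact this rfl
    filter_upwards [hcpt.isClosed.isOpen_compl.mem_nhds hbn] with q hq
    refine or_iff_not_imp_left.2 fun hqb => ?_
    have hqR : R < ‖σ q‖ := by
      by_contra! hle
      exact hq ⟨σ q, by simpa using hle, σ.left_inv (hmem hqb)⟩
    have hRa (a : A) : ‖σ (h a)‖ < ‖σ q‖ := (hR _ (mem_range_self a)).trans_lt hqR
    refine HasNonvanishingExtension.of_norm_sub_lt he (f := fun _ => - σ q)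
      ⟨fun _ => - σ q, continuous_const, fun y h0 => ?_, fun _ => rfl⟩
      (hσh.sub continuous_const) fun a => ?_
    · exact (hR0.trans hqR).ne' (norm_eq_zero.2 (neg_eq_zero.1 h0))
    · simpa using hRa a
  have hPo : IsOpen (P ∩ (range h)ᶜ) := by
    refine isOpen_iff_mem_nhds.2 fun q hq => Filter.inter_mem ?_ (hro.mem_nhds hq.2)
    by_cases hqb : q = b
    · exact hqb ▸ hbnear
    · filter_upwards [hnear hq.2 hqb] with q' hq'
      exact .inr (hq'.2.1 (hq.1.resolve_left hqb))
  have hPco : IsOpen (Pᶜ ∩ (range h)ᶜ) := by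
    refine isOpen_iff_mem_nhds.2 fun q hq => Filter.inter_mem ?_ (hro.mem_nhds hq.2)
    have hqb : q ≠ b := fun hqb => hq.1 (.inl hqb)
    filter_upwards [hnear hq.2 hqb] with q' hq'
    exact fun hP => hq.1 (.inr (hq'.2.2 (hP.resolve_left hq'.1)))
  have := hC.subset_left_of_subset_union hPo hPco
    (disjoint_compl_right.mono inter_subset_left inter_subset_left)
    (fun x hx => by by_cases hxP : x ∈ P <;> simp [hxP, hCh hx])
    ⟨b, hbC, .inl rfl, hCh hbC⟩
  exact (this hpC).1.resolve_left hpb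

end OnePointChart

/-- Let `S` be a closed connected surface in `S³` (a compact connected set every point of which
has an open neighbourhood in `S` homeomorphic to `ℝ²`) separating two nonempty compact
connected sets `K` and `K'`. Then there exists `ε > 0` such that for every continuous injective
map `h : S → S³` moving every point less than `ε`, the surface `S' := h(S)` still separates
`K` and `K'`. -/
theorem separating_surface_stable_under_small_embedding
    (S K K' : Set ↥(Metric.sphere (0 : EuclideanSpace ℝ (Fin 4)) 1))
    (hScomp : IsCompact S) (hScon : IsConnected S)
    (hsurf : ∀ x (hx : x ∈ S), ∃ U : Set ↥S, IsOpen U ∧ (⟨x, hx⟩ : ↥S) ∈ U ∧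
      Nonempty (U ≃ₜ EuclideanSpace ℝ (Fin 2)))
    (hKcomp : IsCompact K) (hKcon : IsConnected K)
    (hK'comp : IsCompact K') (hK'con : IsConnected K')
    (hKS : K ⊆ Sᶜ) (hK'S : K' ⊆ Sᶜ)
    (hsep : ∀ C : Set ↥(Metric.sphere (0 : EuclideanSpace ℝ (Fin 4)) 1),
      C ⊆ Sᶜ → IsPreconnected C → (C ∩ K).Nonempty → (C ∩ K').Nonempty → False) :
    ∃ ε > (0 : ℝ), ∀ h : ↥S → ↥(Metric.sphere (0 : EuclideanSpace ℝ (Fin 4)) 1),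
      Continuous h → Function.Injective h → (∀ x : ↥S, dist (h x) (x : _) < ε) →
      K ⊆ (Set.range h)ᶜ ∧ K' ⊆ (Set.range h)ᶜ ∧
      ∀ C : Set ↥(Metric.sphere (0 : EuclideanSpace ℝ (Fin 4)) 1),
        C ⊆ (Set.range h)ᶜ → IsPreconnected C →
        (C ∩ K).Nonempty → (C ∩ K').Nonempty → False := by
  obtain ⟨a, ha⟩ := hKcon.nonempty
  obtain ⟨b, hb⟩ := hK'con.nonempty
  have hab : a ≠ b := by
    rintro rfl
    exact hsep {a} (by simpa using hKS ha) isPreconnected_singleton ⟨a, rfl, ha⟩ ⟨a, rfl, hb⟩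
  have : Fact (finrank ℝ (EuclideanSpace ℝ (Fin 4)) = 3 + 1) := ⟨by simp⟩
  have : CompactSpace ↥S := isCompact_iff_compactSpace.1 hScomp
  set σ := stereographic' 3 b
  have hsource : σ.source = {b}ᶜ := stereographic'_source b
  have htarget : σ.target = univ := stereographic'_target b
  have hmem {x : sphere (0 : EuclideanSpace ℝ (Fin 4)) 1} (hx : x ≠ b) : x ∈ σ.source := by
    rw [hsource]; exact hx
  have hSb {x : sphere (0 : EuclideanSpace ℝ (Fin 4)) 1} (hx : x ∈ S) : x ≠ b := by
    rintro rfl; exact hK'S hb hx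
  have haS : a ∉ S := hKS ha
  have he : IsClosedEmbedding fun x : S => σ x :=
    Continuous.isClosedEmbedding
      (continuous_iff_continuousAt.2 fun x =>
        (σ.continuousAt (hmem (hSb x.2))).comp continuous_subtype_val.continuousAt)
      fun x y hxy => Subtype.ext (σ.injOn (hmem (hSb x.2)) (hmem (hSb y.2)) hxy)
  obtain ⟨ε₁, hε₁, hthick₁⟩ := hScomp.exists_thickening_subset_open
    (hKcomp.union hK'comp).isClosed.isOpen_compl
    (subset_compl_comm.1 (union_subset hKS hK'S))
  obtain ⟨ε₂, hε₂, hthick₂⟩ : ∃ ε > 0, ∀ x ∈ S, ∀ y, dist y x < ε →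
      ‖σ x - σ y‖ < ‖σ y - σ a‖ := by
    have hcont : ContinuousOn (fun z : sphere (0 : EuclideanSpace ℝ (Fin 4)) 1 ×
        sphere (0 : EuclideanSpace ℝ (Fin 4)) 1 => ‖σ z.2 - σ a‖ - ‖σ z.1 - σ z.2‖)
        (σ.source ×ˢ σ.source) := by
      have h1 := σ.continuousOn.comp continuousOn_fst
        (fun z (hz : z ∈ σ.source ×ˢ σ.source) => hz.1)
      have h2 := σ.continuousOn.comp continuousOn_snd
        (fun z (hz : z ∈ σ.source ×ˢ σ.source) => hz.2)
      exact (h2.sub continuousOn_const).norm.sub (h1.sub h2).norm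
    obtain ⟨ε, hε, hthick⟩ := (hScomp.image (f := fun x => (x, x))
      (by fun_prop)).exists_thickening_subset_open
      (hcont.isOpen_inter_preimage (σ.open_source.prod σ.open_source) isOpen_Ioi (t := Ioi 0))
      (by
        rintro _ ⟨x, hx, rfl⟩
        refine ⟨⟨hmem (hSb hx), hmem (hSb hx)⟩, ?_⟩
        have : σ x ≠ σ a := fun heq =>
          haS (σ.injOn (hmem (hSb hx)) (hmem hab) heq ▸ hx)
        simpa [sub_eq_zero] using this)
    refine ⟨ε, hε, fun x hx y hxy => ?_⟩
    have := (hthick (mem_thickening_iff.2 ⟨(x, x), mem_image_of_mem _ hx,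
      show dist (x, y) (x, x) < ε by simpa [Prod.dist_eq, hε] using hxy⟩)).2
    simpa using this
  refine ⟨min ε₁ ε₂, lt_min hε₁ hε₂, fun h hh _ hclose => ?_⟩
  have hKK' : K ∪ K' ⊆ (range h)ᶜ := by
    rintro _ hx ⟨s, rfl⟩
    exact hthick₁ (mem_thickening_iff.2 ⟨s, s.2, (hclose s).trans_le (min_le_left _ _)⟩) hx
  refine ⟨subset_union_left.trans hKK', subset_union_right.trans hKK',
    fun C hC hCcon hCK hCK' => ?_⟩
  have hconn : IsPreconnected (C ∪ K ∪ K') :=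
    (hCcon.union' hCK hKcon.isPreconnected).union'
      (hCK'.mono (inter_subset_inter_left _ subset_union_left)) hK'con.isPreconnected
  have hext := hconn.hasNonvanishingExtension he hsource htarget hh
    (by rw [union_assoc]; exact union_subset hC hKK') (.inr hb) (.inl (.inr ha)) hab
  have hext' : HasNonvanishingExtension (fun x : S => σ x) fun x : S => σ x - σ a :=
    hext.of_norm_sub_lt he (he.continuous.sub continuous_const) fun s => by
      rw [sub_sub_sub_cancel_right]
      exact hthick₂ s s.2 (h s) ((hclose s).trans_le (min_le_right _ _))
  have haR : σ a ∉ range fun x : S => σ x := by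
    rintro ⟨x, hx⟩
    exact haS (σ.injOn (hmem (hSb x.2)) (hmem hab) hx ▸ x.2)
  have hunb := hext'.not_isBounded_connectedComponentIn (by simp) he haR
  refine hsep _ ?_ (isPreconnected_connectedComponentIn.insert_image_symm_of_not_isBounded
    hsource htarget hunb) ⟨a, .inr ⟨σ a, mem_connectedComponentIn haR, σ.left_inv (hmem hab)⟩, ha⟩
    ⟨b, mem_insert _ _, hb⟩
  rintro _ (rfl | ⟨x, hx, rfl⟩)
  · exact hK'S hb
  · intro hxS
    exact connectedComponentIn_subset _ _ hx ⟨⟨_, hxS⟩, σ.right_inv (by simp [htarget])⟩
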